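/- (Equivalence of GLS and GL-SR-Lasso under homoscedastic noise) For y_Ω ∈ ℂ^L, the optimization problem min over u ∈ ℂ^M (with T(u) ⪰ 0) and σ₁ ≥ 0 of [ L u₁ + L σ₁ + ‖y_Ω‖₂² · y_Ω^H (Γ_Ω T(u) Γ_Ωᵀ + σ₁ I)^{-1} y_Ω ] has optimal value equal to 2√L ‖y_Ω‖₂ · min over z_Ω of [ ‖z_Ω‖_{𝒜(Ω)} + ‖y_Ω − z_Ω‖₂ ], and the optimal u of the first problem equals (‖y_Ω‖₂/√L) times the optimal u of the SDP formulation of the second. -/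

import Mathlib

open Matrix ComplexOrder Complex Real Classical

/-- The Hermitian Toeplitz matrix with first column `u`. -/
def toeplitz {M : ℕ} (u : Fin M → ℂ) : Matrix (Fin M) (Fin M) ℂ :=
  Matrix.of fun i j => if (j : ℕ) ≤ (i : ℕ) then u (i - j) else (starRingEnd ℂ) (u (j - i))

/-- The row-selection matrix `Γ_Ω ∈ {0,1}^{L×M}` for the index map `Ω`. -/
def sel {M L : ℕ} (Ω : Fin L → Fin M) : Matrix (Fin L) (Fin M) ℂ :=
  Matrix.of fun l m => if Ω l = m then 1 else 0

/-- Moore–Penrose pseudoinverse, defined via the Penrose conditions. -/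
noncomputable def pinv {n : Type*} [Fintype n] [DecidableEq n] (A : Matrix n n ℂ) :
    Matrix n n ℂ :=
  if h : ∃ B : Matrix n n ℂ,
      A * B * A = A ∧ B * A * B = B ∧ (A * B)ᴴ = A * B ∧ (B * A)ᴴ = B * A
  then h.choose else 0

/-- The GLS objective value at `(u, σ₁)`:
`L u₁ + L σ₁ + ‖y_Ω‖₂² y_Ωᴴ (Γ_Ω T(u) Γ_Ωᴴ + σ₁ I)⁻¹ y_Ω`
(with the inverse interpreted via the pseudoinverse when singular). -/
noncomputable def glsVal {M L : ℕ} (hM : 0 < M) (Ω : Fin L → Fin M)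
    (y : Fin L → ℂ) (u : Fin M → ℂ) (σ₁ : ℝ) : ℝ :=
  (L : ℝ) * (u ⟨0, hM⟩).re + (L : ℝ) * σ₁ +
    (∑ l, ‖y l‖ ^ 2) *
      (star y ⬝ᵥ (pinv (sel Ω * toeplitz u * (sel Ω)ᴴ +
        (σ₁ : ℂ) • (1 : Matrix (Fin L) (Fin L) ℂ))).mulVec y).re

/-- Feasibility for GLS: `T(u) ⪰ 0`, `σ₁ ≥ 0` and `y_Ω` in the range of the model covariance. -/
def glsFeas {M L : ℕ} (Ω : Fin L → Fin M) (y : Fin L → ℂ) (u : Fin M → ℂ) (σ₁ : ℝ) : Prop :=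
  0 ≤ σ₁ ∧ (toeplitz u).PosSemidef ∧
    ∃ w, (sel Ω * toeplitz u * (sel Ω)ᴴ +
      (σ₁ : ℂ) • (1 : Matrix (Fin L) (Fin L) ℂ)).mulVec w = y

/-- The objective of the SDP formulation of GL-SR-Lasso at `(x, u, z)`:
`(x + u₁)/2 + ‖y_Ω − z_Ω‖₂`. -/
noncomputable def srVal {M L : ℕ} (hM : 0 < M) (Ω : Fin L → Fin M)
    (y : Fin L → ℂ) (x : ℝ) (u : Fin M → ℂ) (z : Fin M → ℂ) : ℝ :=
  (x + (u ⟨0, hM⟩).re) / 2 + Real.sqrt (∑ l, ‖y l - z (Ω l)‖ ^ 2)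

/-- Feasibility for the SDP formulation of GL-SR-Lasso: `[[x, zᴴ],[z, T(u)]] ⪰ 0`. -/
def srFeas {M : ℕ} (x : ℝ) (u : Fin M → ℂ) (z : Fin M → ℂ) : Prop :=
  (Matrix.fromBlocks
    (Matrix.of fun (_ _ : Fin 1) => (x : ℂ))
    (Matrix.of fun (_ : Fin 1) (j : Fin M) => (starRingEnd ℂ) (z j))
    (Matrix.of fun (i : Fin M) (_ : Fin 1) => z i)
    (toeplitz u)).PosSemidef

section Pseudoinverse

variable {n : Type*} [Fintype n] [DecidableEq n]

/-- A Hermitian matrix satisfies the Penrose conditions for some `B`. -/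
lemma Matrix.IsHermitian.exists_penrose {A : Matrix n n ℂ} (hA : A.IsHermitian) :
    ∃ B : Matrix n n ℂ,
      A * B * A = A ∧ B * A * B = B ∧ (A * B)ᴴ = A * B ∧ (B * A)ᴴ = B * A := by
  set U := hA.eigenvectorUnitary
  set D : Matrix n n ℂ := diagonal (fun i => (hA.eigenvalues i : ℂ)) with hD
  set E : Matrix n n ℂ := diagonal (fun i => ((hA.eigenvalues i)⁻¹ : ℂ)) with hE
  have hAD : A = Unitary.conjStarAlgAut ℂ _ U D := hA.spectral_theorem
  have h1 : D * E * D = D := by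
    simp only [hD, hE, diagonal_mul_diagonal]
    congr 1; ext i
    exact mul_inv_mul_cancel _
  have h2 : E * D * E = E := by
    simp only [hD, hE, diagonal_mul_diagonal]
    congr 1; ext i
    by_cases h : (hA.eigenvalues i : ℂ) = 0 <;> simp [h]
  have h3 : star (D * E) = D * E := by
    simp only [hD, hE, diagonal_mul_diagonal, star_eq_conjTranspose, diagonal_conjTranspose]
    congr 1; ext i
    simp
  have h4 : E * D = D * E := by
    simp only [hD, hE, diagonal_mul_diagonal]
    congr 1; ext i
    ring
  refine ⟨Unitary.conjStarAlgAut ℂ _ U E, ?_, ?_, ?_, ?_⟩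
  · rw [hAD, ← map_mul, ← map_mul, h1]
  · rw [hAD, ← map_mul, ← map_mul, h2]
  · rw [hAD, ← map_mul, ← star_eq_conjTranspose, ← map_star, h3]
  · rw [hAD, ← map_mul, ← star_eq_conjTranspose, ← map_star, h4, h3]

lemma pinv_spec {A : Matrix n n ℂ} (hA : A.IsHermitian) :
    A * pinv A * A = A ∧ pinv A * A * pinv A = pinv A ∧
      (A * pinv A)ᴴ = A * pinv A ∧ (pinv A * A)ᴴ = pinv A * A := by
  have h := hA.exists_penrose
  rw [pinv, dif_pos h]
  exact h.choose_spec

lemma star_mulVec_dotProduct {m n : Type*} [Fintype m] [Fintype n] (A : Matrix m n ℂ)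
    (v : n → ℂ) (w : m → ℂ) : star (A *ᵥ v) ⬝ᵥ w = star v ⬝ᵥ (Aᴴ *ᵥ w) := by
  rw [star_mulVec, dotProduct_mulVec]

lemma star_mulVec_dotProduct_pinv {A : Matrix n n ℂ} (hA : A.IsHermitian)
    (w : n → ℂ) :
    star (A *ᵥ w) ⬝ᵥ (pinv A *ᵥ (A *ᵥ w)) = star w ⬝ᵥ (A *ᵥ w) := by
  rw [star_mulVec_dotProduct, hA.eq, mulVec_mulVec, mulVec_mulVec, (pinv_spec hA).1]

/-- A vector orthogonal to the kernel of a Hermitian matrix lies in its range. -/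
lemma Matrix.IsHermitian.exists_mulVec_eq {A : Matrix n n ℂ} (hA : A.IsHermitian) {y : n → ℂ}
    (h : ∀ k, A *ᵥ k = 0 → star y ⬝ᵥ k = 0) : ∃ w, A *ᵥ w = y := by
  obtain ⟨h1, -, -, h4⟩ := pinv_spec hA
  set P := pinv A * A with hP
  have hPP : P * P = P := by rw [hP, mul_assoc, ← mul_assoc A, h1]
  have hk : A *ᵥ (y - P *ᵥ y) = 0 := by
    rw [mulVec_sub, mulVec_mulVec, hP, ← mul_assoc, h1, sub_self]
  have hPk : P *ᵥ (y - P *ᵥ y) = 0 := by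
    rw [mulVec_sub, mulVec_mulVec, hPP, sub_self]
  have h0 : star (y - P *ᵥ y) ⬝ᵥ (y - P *ᵥ y) = 0 := by
    conv_lhs => rw [star_sub, sub_dotProduct, h _ hk, star_mulVec_dotProduct, h4, hPk]
    simp
  rw [dotProduct_star_self_eq_zero, sub_eq_zero] at h0
  refine ⟨(pinv A)ᴴ *ᵥ y, ?_⟩
  rw [hP, conjTranspose_mul, hA.eq, ← hP] at h4
  rw [mulVec_mulVec, h4, ← h0]

/-- Completing the square: an upper bound `C` on `2 Re (yᴴ w) - wᴴ A w` over all `w` forces `y` into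
the range of `A` and bounds `yᴴ A⁺ y`. -/
lemma Matrix.PosSemidef.pinv_le_of_forall {A : Matrix n n ℂ} (hA : A.PosSemidef) {y : n → ℂ}
    {C : ℝ} (h : ∀ w, 2 * (star y ⬝ᵥ w).re ≤ C + (star w ⬝ᵥ (A *ᵥ w)).re) :
    (∃ w, A *ᵥ w = y) ∧ (star y ⬝ᵥ (pinv A *ᵥ y)).re ≤ C := by
  have hr : ∃ w, A *ᵥ w = y := by
    refine hA.isHermitian.exists_mulVec_eq fun k hk => ?_
    set c := star y ⬝ᵥ k with hc
    by_contra hne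
    have hpos : 0 < normSq c := normSq_pos.2 hne
    have := h ((((C + 1) / normSq c : ℝ) * star c) • k)
    rw [mulVec_smul, hk, smul_zero, dotProduct_zero, dotProduct_smul, ← hc, smul_eq_mul, mul_assoc,
      re_ofReal_mul] at this
    have e : (star c * c).re = normSq c := by
      simp [normSq_apply]
    rw [e, div_mul_cancel₀ _ hpos.ne'] at this
    have h0 := h 0
    simp at this h0
    linarith
  refine ⟨hr, ?_⟩
  obtain ⟨w, rfl⟩ := hr
  have := h w
  rw [star_mulVec_dotProduct, hA.isHermitian.eq] at this
  rw [star_mulVec_dotProduct_pinv hA.isHermitian]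
  linarith

end Pseudoinverse

lemma re_star_dotProduct_self {n : Type*} [Fintype n] (v : n → ℂ) :
    (star v ⬝ᵥ v).re = ∑ i, ‖v i‖ ^ 2 := by
  simp [dotProduct, ← normSq_eq_norm_sq, normSq_apply]

lemma eq_zero_of_sqrt_sum_eq_zero {n : Type*} [Fintype n] {v : n → ℂ}
    (h : √(∑ i, ‖v i‖ ^ 2) = 0) : v = 0 := by
  rw [Real.sqrt_eq_zero (by positivity),
    Finset.sum_eq_zero_iff_of_nonneg fun _ _ => by positivity] at h
  ext i
  simpa using h i (Finset.mem_univ i)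

lemma two_mul_re_star_dotProduct_le {n : Type*} [Fintype n] {t : ℝ} (ht : 0 ≤ t) (v w : n → ℂ) :
    2 * t * (star v ⬝ᵥ w).re ≤ ∑ i, ‖v i‖ ^ 2 + t ^ 2 * ∑ i, ‖w i‖ ^ 2 := by
  rw [dotProduct, re_sum, Finset.mul_sum, Finset.mul_sum, ← Finset.sum_add_distrib]
  refine Finset.sum_le_sum fun i _ => ?_
  have h : (star (v i) * w i).re ≤ ‖v i‖ * ‖w i‖ := by
    simpa using re_le_norm (star (v i) * w i)
  have h2 := mul_le_mul_of_nonneg_left h ht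
  simp only [Pi.star_apply]
  nlinarith [sq_nonneg (‖v i‖ - t * ‖w i‖)]

section Toeplitz

variable {M L : ℕ}

lemma toeplitz_real_smul (c : ℝ) (u : Fin M → ℂ) :
    toeplitz (fun i => (c : ℂ) * u i) = (c : ℂ) • toeplitz u := by
  ext i j
  by_cases h : (j : ℕ) ≤ i <;> simp [toeplitz, -Fin.val_fin_le, h]

lemma toeplitz_zero_posSemidef : (toeplitz fun _ : Fin M => 0).PosSemidef := by
  have h := toeplitz_real_smul (M := M) 0 0
  simp only [ofReal_zero, zero_mul, zero_smul] at h
  exact h ▸ PosSemidef.zero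

lemma Matrix.PosSemidef.real_smul {n : Type*} {A : Matrix n n ℂ} (hA : A.PosSemidef) {c : ℝ}
    (hc : 0 ≤ c) : ((c : ℂ) • A).PosSemidef :=
  hA.smul (by exact_mod_cast hc)

lemma re_nonneg_of_toeplitz_posSemidef (hM : 0 < M) {u : Fin M → ℂ} (h : (toeplitz u).PosSemidef) :
    0 ≤ (u ⟨0, hM⟩).re := by
  have := h.diag_nonneg (i := ⟨0, hM⟩)
  simp only [toeplitz, of_apply, le_refl, if_true] at this
  have e : (⟨0, hM⟩ - ⟨0, hM⟩ : Fin M) = ⟨0, hM⟩ := by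
    ext; simp [Fin.sub_def]
  rw [e] at this
  exact (Complex.le_def.1 this).1

lemma sel_mulVec (Ω : Fin L → Fin M) (z : Fin M → ℂ) : sel Ω *ᵥ z = fun l => z (Ω l) := by
  ext l
  simp [sel, mulVec, dotProduct]

/-- The model covariance `Γ_Ω T(u) Γ_Ωᴴ + σ I`. -/
noncomputable def modelCov (Ω : Fin L → Fin M) (u : Fin M → ℂ) (σ : ℝ) : Matrix (Fin L) (Fin L) ℂ :=
  sel Ω * toeplitz u * (sel Ω)ᴴ + (σ : ℂ) • (1 : Matrix (Fin L) (Fin L) ℂ)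

lemma modelCov_posSemidef (Ω : Fin L → Fin M) {u : Fin M → ℂ} (hu : (toeplitz u).PosSemidef)
    {σ : ℝ} (hσ : 0 ≤ σ) : (modelCov Ω u σ).PosSemidef :=
  (hu.mul_mul_conjTranspose_same _).add (PosSemidef.one.real_smul hσ)

lemma modelCov_mulVec (Ω : Fin L → Fin M) (u : Fin M → ℂ) (σ : ℝ) (w : Fin L → ℂ) :
    modelCov Ω u σ *ᵥ w
      = sel Ω *ᵥ (toeplitz u *ᵥ ((sel Ω)ᴴ *ᵥ w)) + (σ : ℂ) • w := by
  simp [modelCov, add_mulVec, mulVec_mulVec, Matrix.mul_assoc, smul_mulVec]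

lemma re_star_dotProduct_modelCov (Ω : Fin L → Fin M) (u : Fin M → ℂ) (σ : ℝ) (w : Fin L → ℂ) :
    (star w ⬝ᵥ (modelCov Ω u σ *ᵥ w)).re
      = (star ((sel Ω)ᴴ *ᵥ w) ⬝ᵥ (toeplitz u *ᵥ ((sel Ω)ᴴ *ᵥ w))).re + σ * ∑ l, ‖w l‖ ^ 2 := by
  rw [modelCov_mulVec, dotProduct_add, dotProduct_smul, smul_eq_mul, add_re, re_ofReal_mul,
    re_star_dotProduct_self, star_mulVec_dotProduct, conjTranspose_conjTranspose]

end Toeplitz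

section Block

variable {M : ℕ} {x : ℝ} {u z : Fin M → ℂ}

lemma srFeas.toeplitz_posSemidef (h : srFeas x u z) : (toeplitz u).PosSemidef :=
  PosSemidef.submatrix h Sum.inr

lemma srFeas.nonneg (h : srFeas x u z) : 0 ≤ x := by
  have := PosSemidef.diag_nonneg h (i := Sum.inl 0)
  simpa using this

lemma srFeas.two_mul_re_le (h : srFeas x u z) (v : Fin M → ℂ) :
    2 * (star z ⬝ᵥ v).re ≤ x + (star v ⬝ᵥ (toeplitz u *ᵥ v)).re := by
  have h1 := PosSemidef.re_dotProduct_nonneg h (Sum.elim (fun _ => -1) v)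
  have e : (star v ⬝ᵥ z).re = (star z ⬝ᵥ v).re := by
    rw [star_dotProduct]; simp
  have e1 : (Matrix.of fun (_ : Fin 1) (j : Fin M) => (starRingEnd ℂ) (z j)) *ᵥ v
      = fun _ => star z ⬝ᵥ v := by
    ext; simp [mulVec, dotProduct]
  have e2 : (Matrix.of fun (i : Fin M) (_ : Fin 1) => z i) *ᵥ (fun _ => (-1 : ℂ)) = -z := by
    ext; simp [mulVec, dotProduct]
  have e3 : (Matrix.of fun (_ _ : Fin 1) => (x : ℂ)) *ᵥ (fun _ => (-1 : ℂ)) = fun _ => -(x : ℂ) := by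
    ext; simp [mulVec, dotProduct]
  have e4 : star (Sum.elim (fun _ : Fin 1 => (-1 : ℂ)) v) = Sum.elim (fun _ => -1) (star v) := by
    ext i; cases i <;> simp
  rw [e4, fromBlocks_mulVec, Sum.elim_comp_inl, Sum.elim_comp_inr, sumElim_dotProduct_sumElim,
    e1, e2, e3] at h1
  have e5 (a : ℂ) : (fun _ : Fin 1 => (-1 : ℂ)) ⬝ᵥ (fun _ => a) = -a := by
    simp [dotProduct]
  simp only [dotProduct_add, dotProduct_neg, e5, neg_neg, RCLike.re_to_complex, add_re, neg_re,
    ofReal_re, e] at h1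
  linarith

lemma srFeas_mulVec (hu : (toeplitz u).PosSemidef) (v : Fin M → ℂ) :
    srFeas (star v ⬝ᵥ (toeplitz u *ᵥ v)).re u (toeplitz u *ᵥ v) := by
  have him : ((star v ⬝ᵥ (toeplitz u *ᵥ v)).re : ℂ) = star v ⬝ᵥ (toeplitz u *ᵥ v) := by
    have := (Complex.le_def.1 (hu.dotProduct_mulVec_nonneg v)).2
    apply Complex.ext <;> simp [← this]
  have h := hu.conjTranspose_mul_mul_same
    (fromCols (Matrix.of fun (i : Fin M) (_ : Fin 1) => v i) (1 : Matrix (Fin M) (Fin M) ℂ))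
  unfold srFeas
  convert h using 1
  rw [conjTranspose_fromCols_eq_fromRows_conjTranspose, fromRows_mul, fromRows_mul_fromCols,
    him]
  congr 1
  · ext i j
    rw [dotProduct_mulVec]
    simp [Matrix.mul_apply, dotProduct, vecMul]
  · ext i j
    have : star (toeplitz u *ᵥ v) j = (star v ᵥ* toeplitz u) j := by
      rw [star_mulVec, hu.isHermitian.eq]
    rw [Matrix.mul_one]
    simpa [Matrix.mul_apply, dotProduct, vecMul] using this
  · ext i j
    simp [Matrix.mul_apply, dotProduct, mulVec]
  · simp

end Block

section Equivalence

variable {M L : ℕ} {hM : 0 < M} {Ω : Fin L → Fin M} {y : Fin L → ℂ}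

lemma glsVal_eq (u : Fin M → ℂ) (σ : ℝ) :
    glsVal hM Ω y u σ = L * (u ⟨0, hM⟩).re + L * σ +
      (∑ l, ‖y l‖ ^ 2) * (star y ⬝ᵥ (pinv (modelCov Ω u σ) *ᵥ y)).re := rfl

lemma glsFeas.val_nonneg {u : Fin M → ℂ} {σ : ℝ} (h : glsFeas Ω y u σ) :
    0 ≤ glsVal hM Ω y u σ := by
  obtain ⟨hσ, hu, w, rfl⟩ := h
  have hR := modelCov_posSemidef Ω hu hσ
  have h1 := re_nonneg_of_toeplitz_posSemidef hM hu
  have h2 := hR.re_dotProduct_nonneg w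
  rw [glsVal_eq, ← modelCov, star_mulVec_dotProduct_pinv hR.isHermitian]
  rw [RCLike.re_to_complex] at h2
  positivity

lemma srFeas.val_nonneg {x : ℝ} {u z : Fin M → ℂ} (h : srFeas x u z) :
    0 ≤ srVal hM Ω y x u z := by
  have h1 := re_nonneg_of_toeplitz_posSemidef hM h.toeplitz_posSemidef
  have h2 := h.nonneg
  unfold srVal
  positivity

lemma glsFeas.exists_srVal_le {u : Fin M → ℂ} {σ : ℝ} (hL : 0 < L)
    (hy : 0 < √(∑ l, ‖y l‖ ^ 2)) (h : glsFeas Ω y u σ) :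
    ∃ x u' z, srFeas x u' z ∧
      2 * √L * √(∑ l, ‖y l‖ ^ 2) * srVal hM Ω y x u' z ≤ glsVal hM Ω y u σ := by
  obtain ⟨hσ, hu, w, hw⟩ := h
  rw [← modelCov] at hw
  have hR := modelCov_posSemidef Ω hu hσ
  have hsq : (∑ l, ‖y l‖ ^ 2) = √(∑ l, ‖y l‖ ^ 2) ^ 2 := (Real.sq_sqrt (by positivity)).symm
  have hl : (L : ℝ) = √L ^ 2 := (Real.sq_sqrt (by positivity)).symm
  have hlpos : 0 < √(L : ℝ) := Real.sqrt_pos.2 (by exact_mod_cast hL)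
  set Y := √(∑ l, ‖y l‖ ^ 2)
  set s := Y / √L with hs
  have hspos : 0 < s := by positivity
  have hsC : (s : ℂ) ≠ 0 := by exact_mod_cast hspos.ne'
  set v := (sel Ω)ᴴ *ᵥ w with hv
  have hT : toeplitz (fun i => ((s⁻¹ : ℝ) : ℂ) * u i) *ᵥ ((s : ℂ) • v) = toeplitz u *ᵥ v := by
    rw [toeplitz_real_smul, smul_mulVec, mulVec_smul, smul_smul, ofReal_inv, inv_mul_cancel₀ hsC,
      one_smul]
  have hf := srFeas_mulVec (u := fun i => ((s⁻¹ : ℝ) : ℂ) * u i)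
    (by rw [toeplitz_real_smul]; exact hu.real_smul (by positivity)) ((s : ℂ) • v)
  refine ⟨_, _, _, hf, ?_⟩
  have hval : (star y ⬝ᵥ (pinv (modelCov Ω u σ) *ᵥ y)).re
      = (star v ⬝ᵥ (toeplitz u *ᵥ v)).re + σ * ∑ l, ‖w l‖ ^ 2 := by
    rw [← hw, star_mulVec_dotProduct_pinv hR.isHermitian, re_star_dotProduct_modelCov]
  have hres : √(∑ l, ‖y l - (toeplitz u *ᵥ v) (Ω l)‖ ^ 2) = σ * √(∑ l, ‖w l‖ ^ 2) := by
    have e (l : Fin L) : ‖y l - (toeplitz u *ᵥ v) (Ω l)‖ ^ 2 = σ ^ 2 * ‖w l‖ ^ 2 := by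
      have : y l = (toeplitz u *ᵥ v) (Ω l) + σ * w l := by
        rw [← congrFun hw l, modelCov_mulVec, sel_mulVec]
        rfl
      rw [this, add_sub_cancel_left, norm_mul, mul_pow, norm_real, Real.norm_eq_abs, sq_abs]
    rw [Finset.sum_congr rfl fun l _ => e l, ← Finset.mul_sum, Real.sqrt_mul (by positivity),
      Real.sqrt_sq hσ]
  rw [hT, glsVal_eq, hval, srVal, hres, star_smul, smul_dotProduct, re_ofReal_mul]
  have hst : star (s : ℂ) = s := conj_ofReal s
  have hw2 : (∑ l, ‖w l‖ ^ 2) = √(∑ l, ‖w l‖ ^ 2) ^ 2 := (Real.sq_sqrt (by positivity)).symm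
  rw [hst, smul_eq_mul, re_ofReal_mul, hsq, hw2, Real.sqrt_sq (by positivity)]
  generalize (star v ⬝ᵥ (toeplitz u *ᵥ v)).re = q
  generalize √(∑ l, ‖w l‖ ^ 2) = e
  generalize (u ⟨0, hM⟩).re = t
  have key : (L : ℝ) * t + L * σ + Y ^ 2 * (q + σ * e ^ 2)
      - 2 * √L * Y * ((s * q + s⁻¹ * t) / 2 + σ * e) = σ * (√L - Y * e) ^ 2 := by
    rw [hs]
    field_simp
    rw [← hl]
    ring_nf
    rw [← hl]
    ring
  nlinarith [mul_nonneg hσ (sq_nonneg (√L - Y * e))]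

lemma srFeas.exists_glsVal_le {x : ℝ} {u z : Fin M → ℂ} (hL : 0 < L)
    (hy : 0 < √(∑ l, ‖y l‖ ^ 2)) (h : srFeas x u z) :
    ∃ σ, glsFeas Ω y (fun i => ((√(∑ l, ‖y l‖ ^ 2) / √L : ℝ) : ℂ) * u i) σ ∧
      glsVal hM Ω y (fun i => ((√(∑ l, ‖y l‖ ^ 2) / √L : ℝ) : ℂ) * u i) σ
        ≤ 2 * √L * √(∑ l, ‖y l‖ ^ 2) * srVal hM Ω y x u z := by
  have hsq : (∑ l, ‖y l‖ ^ 2) = √(∑ l, ‖y l‖ ^ 2) ^ 2 := (Real.sq_sqrt (by positivity)).symm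
  have hl : (L : ℝ) = √L ^ 2 := (Real.sq_sqrt (by positivity)).symm
  have hlpos : 0 < √(L : ℝ) := Real.sqrt_pos.2 (by exact_mod_cast hL)
  set Y := √(∑ l, ‖y l‖ ^ 2)
  set s := Y / √L with hs
  have hspos : 0 < s := by positivity
  have he : (∑ l, ‖y l - z (Ω l)‖ ^ 2) = √(∑ l, ‖y l - z (Ω l)‖ ^ 2) ^ 2 :=
    (Real.sq_sqrt (by positivity)).symm
  unfold srVal
  have he0 : 0 ≤ √(∑ l, ‖y l - z (Ω l)‖ ^ 2) := Real.sqrt_nonneg _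
  set e := √(∑ l, ‖y l - z (Ω l)‖ ^ 2)
  have hu : (toeplitz (fun i => (s : ℂ) * u i)).PosSemidef := by
    rw [toeplitz_real_smul]
    exact h.toeplitz_posSemidef.real_smul hspos.le
  have hσ : 0 ≤ s * e := by positivity
  have hbound (w : Fin L → ℂ) : 2 * (star y ⬝ᵥ w).re
      ≤ (x + e) / s + (star w ⬝ᵥ (modelCov Ω (fun i => (s : ℂ) * u i) (s * e) *ᵥ w)).re := by
    rw [re_star_dotProduct_modelCov, toeplitz_real_smul]
    set v := (sel Ω)ᴴ *ᵥ w with hv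
    have h1 := h.two_mul_re_le ((s : ℂ) • v)
    have hst : star (s : ℂ) = s := conj_ofReal s
    rw [star_smul, smul_dotProduct, dotProduct_smul, mulVec_smul, dotProduct_smul, hst, smul_eq_mul,
      smul_eq_mul, smul_eq_mul, re_ofReal_mul, re_ofReal_mul, re_ofReal_mul, hv,
      ← star_mulVec_dotProduct, sel_mulVec, ← hv] at h1
    have h2 : 2 * s * (star (y - fun l => z (Ω l)) ⬝ᵥ w).re ≤ e + s ^ 2 * e * ∑ i, ‖w i‖ ^ 2 := by
      rcases he0.eq_or_lt with h0 | hpos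
      · have : y - (fun l => z (Ω l)) = 0 := eq_zero_of_sqrt_sum_eq_zero h0.symm
        rw [this, ← h0]
        simp
      · have := two_mul_re_star_dotProduct_le hσ (y - fun l => z (Ω l)) w
        simp only [Pi.sub_apply] at this
        rw [he] at this
        refine le_of_mul_le_mul_left ?_ hpos
        linarith
    rw [star_sub, sub_dotProduct, sub_re] at h2
    rw [smul_mulVec, dotProduct_smul, smul_eq_mul, re_ofReal_mul]
    refine le_of_mul_le_mul_left ?_ hspos
    rw [mul_add, mul_div_cancel₀ _ hspos.ne']
    linarith
  obtain ⟨hr, hp⟩ := (modelCov_posSemidef Ω hu hσ).pinv_le_of_forall hbound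
  refine ⟨s * e, ⟨hσ, hu, hr⟩, ?_⟩
  rw [glsVal_eq, hsq, re_ofReal_mul]
  refine (add_le_add_right (mul_le_mul_of_nonneg_left hp (sq_nonneg Y)) _).trans_eq ?_
  rw [hs]
  field_simp
  rw [← hl]
  ring

end Equivalence

/-- Equivalence of GLS and GL-SR-Lasso under homoscedastic noise: the GLS optimal value equals
`2√L‖y_Ω‖₂` times the optimal value of `min_z ‖z_Ω‖_{𝒜(Ω)} + ‖y_Ω − z_Ω‖₂` (in its SDP form),
and an optimal `u` of GLS is obtained by scaling an optimal `u` of the SDP by `‖y_Ω‖₂/√L`. -/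
theorem gls_equiv_srLasso {M L : ℕ} (hM : 0 < M) (hL : 0 < L)
    (Ω : Fin L → Fin M) (hΩ : StrictMono Ω) (y : Fin L → ℂ) :
    sInf {t : ℝ | ∃ (u : Fin M → ℂ) (σ₁ : ℝ),
        glsFeas Ω y u σ₁ ∧ t = glsVal hM Ω y u σ₁}
      = 2 * Real.sqrt L * Real.sqrt (∑ l, ‖y l‖ ^ 2) *
        sInf {t : ℝ | ∃ (x : ℝ) (u : Fin M → ℂ) (z : Fin M → ℂ),
          srFeas x u z ∧ t = srVal hM Ω y x u z}
    ∧
    ∀ (x : ℝ) (u : Fin M → ℂ) (z : Fin M → ℂ), srFeas x u z →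
      srVal hM Ω y x u z
        = sInf {t : ℝ | ∃ (x' : ℝ) (u' : Fin M → ℂ) (z' : Fin M → ℂ),
            srFeas x' u' z' ∧ t = srVal hM Ω y x' u' z'} →
      ∃ σ₁ : ℝ,
        glsFeas Ω y (fun i => ((Real.sqrt (∑ l, ‖y l‖ ^ 2) / Real.sqrt L : ℝ) : ℂ) * u i) σ₁ ∧
        glsVal hM Ω y (fun i => ((Real.sqrt (∑ l, ‖y l‖ ^ 2) / Real.sqrt L : ℝ) : ℂ) * u i) σ₁
          = sInf {t : ℝ | ∃ (u' : Fin M → ℂ) (σ₁' : ℝ),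
              glsFeas Ω y u' σ₁' ∧ t = glsVal hM Ω y u' σ₁'} := by
  set G := {t : ℝ | ∃ (u : Fin M → ℂ) (σ₁ : ℝ), glsFeas Ω y u σ₁ ∧ t = glsVal hM Ω y u σ₁}
  set S := {t : ℝ | ∃ (x : ℝ) (u : Fin M → ℂ) (z : Fin M → ℂ),
    srFeas x u z ∧ t = srVal hM Ω y x u z}
  have hG : ∀ t ∈ G, 0 ≤ t := by
    rintro t ⟨u, σ, h, rfl⟩
    exact h.val_nonneg
  have hGb : BddBelow G := ⟨0, hG⟩
  have hSb : BddBelow S := by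
    refine ⟨0, ?_⟩
    rintro t ⟨x, u, z, h, rfl⟩
    exact h.val_nonneg
  rcases (Real.sqrt_nonneg (∑ l, ‖y l‖ ^ 2)).eq_or_lt with hy | hy
  · have hy0 : y = 0 := eq_zero_of_sqrt_sum_eq_zero hy.symm
    have hfeas : glsFeas Ω y (fun _ : Fin M => 0) 0 := by
      exact ⟨le_rfl, toeplitz_zero_posSemidef, 0, by simp [hy0]⟩
    have hval : glsVal hM Ω y (fun _ : Fin M => 0) 0 = 0 := by
      simp [glsVal, hy0]
    have hinf : sInf G = 0 :=
      le_antisymm (hval ▸ csInf_le hGb ⟨_, _, hfeas, rfl⟩) (Real.sInf_nonneg hG)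
    rw [hinf, ← hy]
    simp only [mul_zero, zero_mul, zero_div, ofReal_zero, true_and]
    exact fun _ _ _ _ _ => ⟨0, hfeas, hval⟩
  · have hc : 0 < 2 * √L * √(∑ l, ‖y l‖ ^ 2) := by positivity
    have hSne : S.Nonempty := 
      ⟨_, _, _, _, srFeas_mulVec toeplitz_zero_posSemidef 0, rfl⟩
    have hGne : G.Nonempty := by
      obtain ⟨t, x, u, z, h, -⟩ := hSne
      obtain ⟨σ, hσ, -⟩ := h.exists_glsVal_le (hM := hM) (Ω := Ω) hL hy
      exact ⟨_, _, _, hσ, rfl⟩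
    have hinf : sInf G = 2 * √L * √(∑ l, ‖y l‖ ^ 2) * sInf S := by
      refine le_antisymm ?_ (le_csInf hGne ?_)
      · rw [← div_le_iff₀' hc]
        refine le_csInf hSne ?_
        rintro t ⟨x, u, z, h, rfl⟩
        obtain ⟨σ, hσ, hle⟩ := h.exists_glsVal_le (hM := hM) (Ω := Ω) hL hy
        rw [div_le_iff₀' hc]
        exact (csInf_le hGb ⟨_, _, hσ, rfl⟩).trans hle
      · rintro t ⟨u, σ, h, rfl⟩
        obtain ⟨x, u', z, hf, hle⟩ := h.exists_srVal_le (hM := hM) hL hy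
        exact (mul_le_mul_of_nonneg_left (csInf_le hSb ⟨_, _, _, hf, rfl⟩) hc.le).trans hle
    refine ⟨hinf, fun x u z h hopt => ?_⟩
    obtain ⟨σ, hσ, hle⟩ := h.exists_glsVal_le (hM := hM) (Ω := Ω) hL hy
    refine ⟨σ, hσ, le_antisymm ?_ (csInf_le hGb ⟨_, _, hσ, rfl⟩)⟩
    rwa [hinf, ← hopt]
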